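/- Let n = 1, v = 0, Q positive definite, Y₁ = 1, and let ψ = X Σ⁻¹ Xᵀ ∈ (0,1), where X ∈ ℝ^{1×p} is nonzero. Then the L²-geometric convergence rate ρ** of the Albert–Chib chain satisfies ρ** ≥ 1 − (1−ψ)/(1−2/π); consequently 1 − ρ** = O(1 − ψ) as ψ → 1, so ρ** is not bounded away from 1 if ψ is not bounded away from 1. -/

import Mathlib

open MeasureTheory Matrix Filter

noncomputable section

/-- standard normal pdf -/
def nphi (x : ℝ) : ℝ := (Real.sqrt (2 * Real.pi))⁻¹ * Real.exp (-(x ^ 2) / 2)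

/-- standard normal cdf -/
def nPhi (x : ℝ) : ℝ := ∫ t in Set.Iic x, nphi t

/-- density of TN(θ,1;1) (if b = true) resp. TN(θ,1;0) (if b = false) at z -/
def tn (θ : ℝ) (b : Bool) (z : ℝ) : ℝ :=
  if b then (if 0 < z then nphi (z - θ) / nPhi θ else 0)
  else (if z < 0 then nphi (z - θ) / (1 - nPhi θ) else 0)

/-- p-variate Gaussian density with mean μ and covariance matrix Λ -/
def mvn {p : ℕ} (μ : Fin p → ℝ) (Λ : Matrix (Fin p) (Fin p) ℝ) (x : Fin p → ℝ) : ℝ :=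
  Real.sqrt (((2 * Real.pi) ^ p * Λ.det)⁻¹) *
    Real.exp (-(dotProduct (x - μ) (Λ⁻¹.mulVec (x - μ))) / 2)

/-- squared Euclidean norm -/
def normSq {m : ℕ} (x : Fin m → ℝ) : ℝ := ∑ i, x i ^ 2

/-- Albert and Chib's Markov transition density, with Σ = XᵀX + Q -/
def kAC {n p : ℕ} (X : Matrix (Fin n) (Fin p) ℝ) (Y : Fin n → Bool)
    (v : Fin p → ℝ) (Q : Matrix (Fin p) (Fin p) ℝ) (β β' : Fin p → ℝ) : ℝ :=
  ∫ z : Fin n → ℝ,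
    mvn ((Xᵀ * X + Q)⁻¹.mulVec (Xᵀ.mulVec z + Q.mulVec v)) (Xᵀ * X + Q)⁻¹ β' *
      ∏ i, tn (dotProduct (X i) β) (Y i) (z i)

/-- the defining property of the posterior mode B̂ -/
def IsPosteriorMode {n p : ℕ} (X : Matrix (Fin n) (Fin p) ℝ) (Y : Fin n → Bool)
    (v : Fin p → ℝ) (Q : Matrix (Fin p) (Fin p) ℝ) (Bhat : Fin p → ℝ) : Prop :=
  (∑ i, (if Y i then nphi (dotProduct (X i) Bhat) / nPhi (dotProduct (X i) Bhat)
          else -(nphi (dotProduct (X i) Bhat) / (1 - nPhi (dotProduct (X i) Bhat)))) • X i)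
    - Q.mulVec (Bhat - v) = 0

/-- `kIter k m` is the (m+1)-step transition density associated with a transition
density `k`. -/
def kIter {A : Type*} [MeasureSpace A] (k : A → A → ℝ) : ℕ → A → A → ℝ
  | 0 => k
  | m + 1 => fun x y => ∫ z, kIter k m x z * k z y

/-- unnormalized posterior density -/
def postUnnorm {n p : ℕ} (X : Matrix (Fin n) (Fin p) ℝ) (Y : Fin n → Bool)
    (v : Fin p → ℝ) (Q : Matrix (Fin p) (Fin p) ℝ) (β : Fin p → ℝ) : ℝ :=
  (∏ i, if Y i then nPhi (dotProduct (X i) β) else 1 - nPhi (dotProduct (X i) β)) *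
    Real.exp (-(dotProduct (β - v) (Q.mulVec (β - v))) / 2)

/-- the (normalized) posterior density -/
def postDen {n p : ℕ} (X : Matrix (Fin n) (Fin p) ℝ) (Y : Fin n → Bool)
    (v : Fin p → ℝ) (Q : Matrix (Fin p) (Fin p) ℝ) (β : Fin p → ℝ) : ℝ :=
  postUnnorm X Y v Q β / ∫ β', postUnnorm X Y v Q β'

/-- the L²-geometric convergence rate of a chain with transition density k and
stationary density pi -/
def rhoSS {p : ℕ} (k : (Fin p → ℝ) → (Fin p → ℝ) → ℝ) (pi : (Fin p → ℝ) → ℝ) : ℝ :=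
  sInf {ρ : ℝ | ρ ∈ Set.Icc (0 : ℝ) 1 ∧ ∀ ν : (Fin p → ℝ) → ℝ,
    (∀ β, 0 ≤ ν β) → (∫ β, ν β) = 1 →
    Integrable (fun β => ν β ^ 2 / pi β) →
    ∃ Mν : ℝ, ∀ m : ℕ,
      (∫ β', |(∫ β, kIter k m β β' * ν β) - pi β'|) ≤ Mν * ρ ^ (m + 1)}

set_option linter.unusedSectionVars false
set_option linter.unusedVariables false

/-- bounded measurable function -/
def BM {A : Type*} [MeasurableSpace A] (f : A → ℝ) : Prop := Measurable f ∧ ∃ C, ∀ x, |f x| ≤ C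

/-- Markov transition density -/
structure MD {A C : Type*} [MeasurableSpace A] [MeasureSpace C] (a : A → C → ℝ) : Prop where
  meas : Measurable (Function.uncurry a)
  nonneg : ∀ x y, 0 ≤ a x y
  one : ∀ x, ∫ y, a x y = 1

/-- integral operator -/
def opr {A C : Type*} [MeasureSpace C] (a : A → C → ℝ) (f : C → ℝ) (x : A) : ℝ := ∫ y, a x y * f y

section abs
variable {A C : Type*} [MeasureSpace A] [MeasureSpace C]
  [SFinite (volume : Measure A)] [SFinite (volume : Measure C)]

theorem integrable_of_one {f : A → ℝ} (h : ∫ x, f x = 1) : Integrable f := by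
  by_contra hc
  rw [integral_undef hc] at h
  norm_num at h

theorem BM.const (c : ℝ) : BM (fun _ : A => c) := ⟨measurable_const, |c|, fun _ => le_rfl⟩

theorem BM.mul {f g : A → ℝ} (hf : BM f) (hg : BM g) : BM (fun x => f x * g x) := by
  obtain ⟨hf, a, ha⟩ := hf
  obtain ⟨hg, b, hb⟩ := hg
  refine ⟨hf.mul hg, a * b, fun x => ?_⟩
  rw [abs_mul]
  exact mul_le_mul (ha x) (hb x) (abs_nonneg _) ((abs_nonneg _).trans (ha x))

theorem BM.add {f g : A → ℝ} (hf : BM f) (hg : BM g) : BM (fun x => f x + g x) := by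
  obtain ⟨hf, a, ha⟩ := hf
  obtain ⟨hg, b, hb⟩ := hg
  exact ⟨hf.add hg, a + b, fun x => (abs_add_le _ _).trans (add_le_add (ha x) (hb x))⟩

theorem Integrable.mulBM {w f : A → ℝ} (hw : Integrable w) (hf : BM f) :
    Integrable (fun x => w x * f x) := by
  obtain ⟨hf, a, ha⟩ := hf
  exact hw.mul_bdd hf.aestronglyMeasurable (Eventually.of_forall ha)

theorem MD.int {a : A → C → ℝ} (h : MD a) (x : A) : Integrable (a x) := integrable_of_one (h.one x)

theorem MD.meas_right {a : A → C → ℝ} (h : MD a) (x : A) : Measurable (a x) :=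
  h.meas.comp measurable_prodMk_left

theorem MD.op_le {a : A → C → ℝ} (h : MD a) {f : C → ℝ} {K : ℝ} (hf : BM f)
    (hK : ∀ x, |f x| ≤ K) (x : A) : |opr a f x| ≤ K := by
  calc |opr a f x| ≤ ∫ y, |a x y * f y| := abs_integral_le_integral_abs
    _ ≤ ∫ y, a x y * K := by
      refine integral_mono (Integrable.mulBM (h.int x) hf).abs ((h.int x).mul_const _) fun y => ?_
      simp only [abs_mul, abs_of_nonneg (h.nonneg x y)]
      exact mul_le_mul_of_nonneg_left (hK y) (h.nonneg x y)
    _ = K := by rw [integral_mul_const, h.one, one_mul]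

theorem MD.op_BM {a : A → C → ℝ} (h : MD a) {f : C → ℝ} (hf : BM f) : BM (opr a f) := by
  obtain ⟨K, hK⟩ := hf.2
  refine ⟨?_, K, h.op_le hf hK⟩
  have : Measurable (fun p : A × C => a p.1 p.2 * f p.2) := h.meas.mul (hf.1.comp measurable_snd)
  exact (this.stronglyMeasurable.integral_prod_right').measurable

theorem MD.op_const {a : A → C → ℝ} (h : MD a) (c : ℝ) (x : A) : opr a (fun _ => c) x = c := by
  simp [opr, integral_mul_const, h.one]

theorem MD.op_add {a : A → C → ℝ} (h : MD a) {f g : C → ℝ} (hf : BM f) (hg : BM g) (x : A) :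
    opr a (fun y => f y + g y) x = opr a f x + opr a g x := by
  simp only [opr, mul_add]
  exact integral_add (Integrable.mulBM (h.int x) hf) (Integrable.mulBM (h.int x) hg)

theorem MD.joint_int {a : A → C → ℝ} (h : MD a) {w : A → ℝ} (hw : Integrable w) :
    Integrable (fun p : A × C => w p.1 * a p.1 p.2) := by
  have hm : AEStronglyMeasurable (fun p : A × C => w p.1 * a p.1 p.2)
      ((volume : Measure A).prod (volume : Measure C)) :=
    hw.1.comp_fst.mul h.meas.aestronglyMeasurable
  refine (integrable_prod_iff hm).2 ⟨Eventually.of_forall fun x => (h.int x).const_mul (w x), ?_⟩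
  simp only [norm_mul, Real.norm_eq_abs, abs_of_nonneg (h.nonneg _ _)]
  simp only [integral_const_mul, h.one, mul_one]
  exact hw.abs

theorem int_quad {f g k : A → ℝ} (hf : Integrable f) (hg : Integrable g) (hk : Integrable k)
    (a b c : ℝ) : ∫ x, (a * f x + b * g x + c * k x) =
      a * (∫ x, f x) + b * (∫ x, g x) + c * ∫ x, k x := by
  have h1 : Integrable (fun x => a * f x + b * g x) := (hf.const_mul a).add (hg.const_mul b)
  rw [integral_add h1 (hk.const_mul c), integral_add (hf.const_mul a) (hg.const_mul b),
    integral_const_mul, integral_const_mul, integral_const_mul]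

/-- weighted Cauchy-Schwarz -/
theorem wCS {w f g : A → ℝ} (hw : Integrable w) (h0 : ∀ x, 0 ≤ w x) (hf : BM f) (hg : BM g) :
    (∫ x, w x * (f x * g x)) ^ 2 ≤ (∫ x, w x * (f x * f x)) * ∫ x, w x * (g x * g x) := by
  have key : ∀ s : ℝ, 0 ≤ (∫ x, w x * (f x * f x)) * (s * s) + (2 * ∫ x, w x * (f x * g x)) * s
      + ∫ x, w x * (g x * g x) := by
    intro s
    have h1 := Integrable.mulBM hw (hf.mul hf)
    have h2 := Integrable.mulBM hw (hf.mul hg)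
    have h3 := Integrable.mulBM hw (hg.mul hg)
    have : (∫ x, w x * (f x * f x)) * (s * s) + (2 * ∫ x, w x * (f x * g x)) * s
      + ∫ x, w x * (g x * g x) = ∫ x, w x * (s * f x + g x) ^ 2 := by
      have := int_quad h1 h2 h3 (s * s) (2 * s) 1
      refine Eq.trans ?_ (this.symm.trans ?_)
      · ring
      · congr 1; ext x; ring
    rw [this]
    exact integral_nonneg fun x => mul_nonneg (h0 x) (sq_nonneg _)
  have := discrim_le_zero key
  rw [discrim] at this
  nlinarith

/-- Data augmentation structure. -/
structure DA (π : A → ℝ) (μ : C → ℝ) (t : A → C → ℝ) (q : C → A → ℝ) : Prop where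
  ht : MD t
  hq : MD q
  pim : Measurable π
  pi0 : ∀ x, 0 < π x
  pi1 : ∫ x, π x = 1
  mum : Measurable μ
  mu0 : ∀ x, 0 ≤ μ x
  bal : ∀ x z, π x * t x z = μ z * q z x
  bd : ∃ c, ∀ z x, q z x ≤ c

/-- the kernel -/
def kk (t : A → C → ℝ) (q : C → A → ℝ) (x y : A) : ℝ := ∫ z, q z y * t x z

variable {π : A → ℝ} {μ : C → ℝ} {t : A → C → ℝ} {q : C → A → ℝ}

theorem DA.piI (h : DA π μ t q) : Integrable π := integrable_of_one h.pi1

theorem DA.joint (h : DA π μ t q) : Integrable (fun p : A × C => π p.1 * t p.1 p.2) :=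
  h.ht.joint_int h.piI

theorem DA.mu1 (h : DA π μ t q) : ∫ z, μ z = 1 := by
  have := integral_integral_swap (f := fun x z => π x * t x z) h.joint
  simp only [integral_const_mul, h.ht.one, mul_one, h.pi1] at this
  simp only [h.bal, integral_const_mul, h.hq.one, mul_one] at this
  exact this.symm

theorem DA.muI (h : DA π μ t q) : Integrable μ := integrable_of_one h.mu1

theorem DA.adj (h : DA π μ t q) {f : C → ℝ} {g : A → ℝ} (hf : BM f) (hg : BM g) :
    ∫ x, π x * (g x * opr t f x) = ∫ z, μ z * (f z * opr q g z) := by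
  have hBM : BM (fun p : A × C => g p.1 * f p.2) := by
    have h1 : BM (fun p : A × C => g p.1) := ⟨hg.1.comp measurable_fst, hg.2.imp fun K hK p => hK _⟩
    have h2 : BM (fun p : A × C => f p.2) := ⟨hf.1.comp measurable_snd, hf.2.imp fun K hK p => hK _⟩
    exact h1.mul h2
  have := integral_integral_swap (f := fun x z => π x * t x z * (g x * f z))
    (Integrable.mulBM h.joint hBM)
  calc _ = ∫ x, ∫ z, π x * t x z * (g x * f z) := by
        congr 1; ext x
        rw [opr, ← integral_const_mul, ← integral_const_mul]
        congr 1; ext z; ring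
    _ = _ := this
    _ = _ := by
        congr 1; ext z
        rw [opr, ← integral_const_mul, ← integral_const_mul]
        congr 1; ext x; rw [h.bal]; ring

theorem DA.k_int (h : DA π μ t q) (x y : A) : Integrable (fun z => q z y * t x z) := by
  obtain ⟨c, hc⟩ := h.bd
  refine (h.ht.int x).bdd_mul (c := c)
    (h.hq.meas.comp measurable_prodMk_right).aestronglyMeasurable (Eventually.of_forall fun z => ?_)
  rw [Real.norm_eq_abs, abs_of_nonneg (h.hq.nonneg _ _)]
  exact hc z y

theorem DA.k_nonneg (h : DA π μ t q) (x y : A) : 0 ≤ kk t q x y :=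
  integral_nonneg fun z => mul_nonneg (h.hq.nonneg _ _) (h.ht.nonneg _ _)

theorem DA.k_le (h : DA π μ t q) : ∃ c, ∀ x y, kk t q x y ≤ c := by
  obtain ⟨c, hc⟩ := h.bd
  refine ⟨c, fun x y => ?_⟩
  calc kk t q x y ≤ ∫ z, c * t x z :=
        integral_mono (h.k_int x y) ((h.ht.int x).const_mul c)
          fun z => mul_le_mul_of_nonneg_right (hc z y) (h.ht.nonneg x z)
    _ = c := by rw [integral_const_mul, h.ht.one, mul_one]

theorem DA.k_op (h : DA π μ t q) {g : A → ℝ} (hg : BM g) (x : A) :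
    opr (kk t q) g x = opr t (opr q g) x := by
  have hj : Integrable (fun p : C × A => t x p.1 * q p.1 p.2) := h.hq.joint_int (h.ht.int x)
  have h2 : BM (fun p : C × A => g p.2) := ⟨hg.1.comp measurable_snd, hg.2.imp fun K hK p => hK _⟩
  have := integral_integral_swap (f := fun z y => t x z * q z y * g y) (Integrable.mulBM hj h2)
  calc _ = ∫ y, ∫ z, t x z * q z y * g y := by
        simp only [opr, kk]
        congr 1; ext y; rw [← integral_mul_const]; congr 1; ext z; ring
    _ = _ := this.symm
    _ = _ := by
        simp only [opr]
        congr 1; ext y; rw [← integral_const_mul]; congr 1; ext z; ring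

theorem DA.k_MD (h : DA π μ t q) : MD (kk t q) := by
  refine ⟨?_, h.k_nonneg, fun x => ?_⟩
  · have : Measurable (fun p : (A × A) × C => q p.2 p.1.2 * t p.1.1 p.2) :=
      (h.hq.meas.comp (measurable_snd.prodMk (measurable_snd.comp measurable_fst))).mul
      (h.ht.meas.comp ((measurable_fst.comp measurable_fst).prodMk measurable_snd))
    exact this.stronglyMeasurable.integral_prod_right'.measurable
  · have := h.k_op (BM.const 1) x
    have h1 : opr q (fun _ : A => (1:ℝ)) = fun _ => 1 := by ext z; exact h.hq.op_const 1 z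
    rw [h1, h.ht.op_const] at this
    simpa [opr] using this

theorem DA.rev (h : DA π μ t q) (x y : A) : π x * kk t q x y = π y * kk t q y x := by
  simp only [kk, ← integral_const_mul]
  congr 1; ext z
  linear_combination q z y * h.bal x z - q z x * h.bal y z

theorem MD.iter {k : A → A → ℝ} (h : MD k) (hb : ∃ c, ∀ x y, k x y ≤ c) (m : ℕ) :
    MD (kIter k m) := by
  obtain ⟨c, hc⟩ := hb
  induction m with
  | zero => exact h
  | succ m ih =>
    refine ⟨?_, fun x y => integral_nonneg fun z => mul_nonneg (ih.nonneg _ _) (h.nonneg _ _),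
      fun x => ?_⟩
    · have : Measurable (fun p : (A × A) × A => kIter k m p.1.1 p.2 * k p.2 p.1.2) :=
        (ih.meas.comp ((measurable_fst.comp measurable_fst).prodMk measurable_snd)).mul
        (h.meas.comp (measurable_snd.prodMk (measurable_snd.comp measurable_fst)))
      exact this.stronglyMeasurable.integral_prod_right'.measurable
    · have hj : Integrable (fun p : A × A => kIter k m x p.1 * k p.1 p.2) := h.joint_int (ih.int x)
      have := integral_integral_swap (f := fun z y => kIter k m x z * k z y) hj
      simp only [integral_const_mul, h.one, mul_one, ih.one] at this
      exact this.symm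

theorem MD.push_succ {k : A → A → ℝ} (h : MD k) (hb : ∃ c, ∀ x y, k x y ≤ c) (m : ℕ)
    {ν : A → ℝ} (hν : Integrable ν) (y : A) :
    ∫ x, kIter k (m + 1) x y * ν x = ∫ z, (∫ x, kIter k m x z * ν x) * k z y := by
  have ih := h.iter hb m
  obtain ⟨c, hc⟩ := hb
  have hj : Integrable (fun p : A × A => ν p.1 * kIter k m p.1 p.2) := ih.joint_int hν
  have hB : BM (fun p : A × A => k p.2 y) :=
    ⟨h.meas.comp (measurable_snd.prodMk measurable_const), c, fun p => by
      rw [abs_of_nonneg (h.nonneg _ _)]; exact hc _ _⟩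
  have := integral_integral_swap (f := fun x z => ν x * kIter k m x z * k z y)
    (Integrable.mulBM hj hB)
  calc _ = ∫ x, ∫ z, ν x * kIter k m x z * k z y := by
        congr 1; ext x
        rw [kIter, ← integral_mul_const]
        congr 1; ext z; ring
    _ = _ := this
    _ = _ := by
        congr 1; ext z
        rw [← integral_mul_const]
        congr 1; ext x; ring

theorem MD.push_int {k : A → A → ℝ} (h : MD k) {ν : A → ℝ} (hν : Integrable ν) :
    Integrable (fun y => ∫ x, k x y * ν x) ∧ ∫ y, (∫ x, k x y * ν x) = ∫ x, ν x := by
  have hj : Integrable (fun p : A × A => ν p.1 * k p.1 p.2) := h.joint_int hν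
  have h1 := hj.integral_prod_right
  have h2 := integral_integral_swap (f := fun x z => ν x * k x z) hj
  simp only [integral_const_mul, h.one, mul_one] at h2
  simp only [mul_comm _ (ν _)]
  exact ⟨h1, h2.symm⟩

/-- iterates of the marginal chain on the z side -/
def uu (t : A → C → ℝ) (q : C → A → ℝ) (f : C → ℝ) : ℕ → C → ℝ
  | 0 => f
  | n + 1 => opr q (opr t (uu t q f n))

theorem DA.uu_BM (h : DA π μ t q) {f : C → ℝ} (hf : BM f) (n : ℕ) : BM (uu t q f n) := by
  induction n with
  | zero => exact hf
  | succ n ih => exact h.hq.op_BM (h.ht.op_BM ih)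

theorem DA.push (h : DA π μ t q) {f : C → ℝ} (hf : BM f) (m : ℕ) (y : A) :
    ∫ x, kIter (kk t q) m x y * (π x * (1 + opr t f x)) = π y * (1 + opr t (uu t q f (m + 1)) y) := by
  have step : ∀ (g : C → ℝ), BM g → ∀ y, ∫ x, π x * (1 + opr t g x) * kk t q x y =
      π y * (1 + opr t (opr q (opr t g)) y) := by
    intro g hg y
    have hB := h.ht.op_BM hg
    have e1 := h.k_op ((BM.const 1).add hB) y
    have e2 := h.k_MD.op_add (BM.const 1) hB y
    rw [h.k_MD.op_const, h.k_op hB] at e2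
    rw [← e2, opr, ← integral_const_mul]
    congr 1; ext x
    linear_combination (1 + opr t g x) * h.rev x y
  have hν : Integrable (fun x => π x * (1 + opr t f x)) :=
    Integrable.mulBM h.piI ((BM.const 1).add (h.ht.op_BM hf))
  induction m generalizing y with
  | zero =>
    rw [uu, uu, ← step f hf y]
    simp only [kIter]
    congr 1; ext x; ring
  | succ m ih =>
    rw [h.k_MD.push_succ h.k_le m hν y]
    simp only [ih]
    rw [step _ (h.uu_BM hf _)]
    rfl

/-- b sequence -/
def bb (μ : C → ℝ) (t : A → C → ℝ) (q : C → A → ℝ) (f : C → ℝ) (n : ℕ) : ℝ :=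
  ∫ z, μ z * (f z * uu t q f n z)

theorem DA.symm (h : DA π μ t q) {f g : C → ℝ} (hf : BM f) (hg : BM g) :
    ∫ z, μ z * (f z * opr q (opr t g) z) = ∫ z, μ z * (opr q (opr t f) z * g z) := by
  rw [← h.adj hf (h.ht.op_BM hg)]
  simp only [mul_comm (opr q (opr t f) _)]
  rw [← h.adj hg (h.ht.op_BM hf)]
  simp only [mul_comm (opr t f _)]

theorem DA.shift (h : DA π μ t q) {f : C → ℝ} (hf : BM f) (m n : ℕ) :
    ∫ z, μ z * (uu t q f m z * uu t q f n z) = bb μ t q f (m + n) := by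
  induction m generalizing n with
  | zero => simp [bb, uu]
  | succ m ih =>
    have := h.symm (h.uu_BM hf m) (h.uu_BM hf n)
    rw [uu, ← this]
    have := ih (n + 1)
    rw [uu] at this
    rw [this]; congr 1; ring

theorem DA.log_cvx (h : DA π μ t q) {f : C → ℝ} (hf : BM f) (m : ℕ) :
    bb μ t q f m ^ 2 ≤ bb μ t q f 0 * bb μ t q f (2 * m) := by
  have := wCS h.muI h.mu0 hf (h.uu_BM hf m)
  rw [h.shift hf] at this
  rw [two_mul]
  exact this

theorem pow_bound {b : ℕ → ℝ} (h0 : 0 ≤ b 0) (h1 : 0 ≤ b 1) (h : ∀ m, b m ^ 2 ≤ b 0 * b (2 * m)) {M ρ : ℝ}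
    (hρ : 0 ≤ ρ) (hb : ∀ m, b (m + 2) ≤ M * ρ ^ (m + 1)) : b 1 ≤ ρ * b 0 := by
  rcases h0.eq_or_lt with h0 | h0
  · have := h 1
    rw [← h0] at this ⊢
    nlinarith
  by_contra hc
  push Not at hc
  have hr : ρ < b 1 / b 0 := by rwa [lt_div_iff₀ h0]
  set r := b 1 / b 0 with hrd
  have hr0 : 0 < r := hρ.trans_lt hr
  have hlow : ∀ j : ℕ, b 0 * r ^ (2 ^ j) ≤ b (2 ^ j) := by
    intro j
    induction j with
    | zero => simp only [pow_zero, pow_one, hrd]; field_simp; exact le_rfl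
    | succ j ih =>
      have h2 := h (2 ^ j)
      have h3 : (b 0 * r ^ (2 ^ j)) ^ 2 ≤ b (2 ^ j) ^ 2 := pow_le_pow_left₀ (by positivity) ih 2
      have h4 : b 0 * (b 0 * r ^ (2 ^ (j + 1))) ≤ b 0 * b (2 ^ (j + 1)) := by
        calc b 0 * (b 0 * r ^ (2 ^ (j + 1))) = (b 0 * r ^ (2 ^ j)) ^ 2 := by
              rw [pow_succ 2 j, pow_mul]; ring
          _ ≤ _ := h3.trans h2
          _ = _ := by rw [pow_succ' 2 j]
      exact le_of_mul_le_mul_left h4 h0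
  have hup : ∀ j : ℕ, b 0 * r * r ^ (2 ^ (j + 1) - 1) ≤ M * ρ ^ (2 ^ (j + 1) - 1) := by
    intro j
    have hj : 2 ≤ 2 ^ (j + 1) := by rw [pow_succ]; have := Nat.one_le_two_pow (n := j); omega
    obtain ⟨n, hn⟩ := Nat.exists_eq_add_of_le' hj
    have := (hlow (j + 1))
    rw [hn] at this ⊢
    calc _ = b 0 * r ^ (n + 2) := by rw [show n + 2 - 1 = n + 1 by omega]; ring
      _ ≤ _ := this
      _ ≤ _ := hb n
  have hT : Tendsto (fun j : ℕ => M * (ρ / r) ^ (2 ^ (j + 1) - 1)) atTop (nhds (M * 0)) := by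
    refine Tendsto.const_mul M ?_
    refine (tendsto_pow_atTop_nhds_zero_of_lt_one (by positivity) (by rwa [div_lt_one hr0])).comp ?_
    refine tendsto_atTop_mono (f := fun j => j) (fun j => ?_) tendsto_id
    have := (j + 1).lt_two_pow_self
    omega
  have : b 0 * r ≤ M * 0 := by
    refine ge_of_tendsto hT (Eventually.of_forall fun j => ?_)
    have hq : M * (ρ / r) ^ (2 ^ (j + 1) - 1)
        = (M * ρ ^ (2 ^ (j + 1) - 1)) / r ^ (2 ^ (j + 1) - 1) := by rw [div_pow]; ring
    rw [hq, le_div_iff₀ (pow_pos hr0 _)]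
    exact hup j
  have := mul_pos h0 hr0
  linarith

theorem DA.rate (h : DA π μ t q) {f : C → ℝ} (hf : BM f) (hf1 : ∀ z, |f z| ≤ 1)
    (hf0 : ∫ z, μ z * f z = 0) {ρ : ℝ} (hρ : 0 ≤ ρ)
    (H : ∀ ν : A → ℝ, (∀ β, 0 ≤ ν β) → (∫ β, ν β) = 1 →
    Integrable (fun β => ν β ^ 2 / π β) →
    ∃ Mν : ℝ, ∀ m : ℕ,
      (∫ β', |(∫ β, kIter (kk t q) m β β' * ν β) - π β'|) ≤ Mν * ρ ^ (m + 1)) :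
    bb μ t q f 1 ≤ ρ * bb μ t q f 0 := by
  have hB := h.ht.op_BM hf
  have hT1 := h.ht.op_le hf hf1
  obtain ⟨M, hM⟩ := H (fun x => π x * (1 + opr t f x))
    (fun x => mul_nonneg (h.pi0 x).le (by linarith [(abs_le.1 (hT1 x)).1])) (by
      simp only [mul_add, mul_one]
      rw [integral_add h.piI (Integrable.mulBM h.piI hB), h.pi1]
      have := h.adj hf (BM.const 1)
      simp only [one_mul, h.hq.op_const, mul_one, hf0] at this
      rw [this, add_zero]) (by
      have := Integrable.mulBM h.piI (((BM.const 1).add hB).mul ((BM.const 1).add hB))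
      refine this.congr (Eventually.of_forall fun x => ?_)
      have := (h.pi0 x).ne'
      simp only
      field_simp)
  have e1 : bb μ t q f 1 = ∫ x, π x * (opr t f x * opr t f x) := by
    rw [h.adj hf hB]; rfl
  refine pow_bound (b := bb μ t q f) ?_ ?_ (h.log_cvx hf) hρ (M := M) ?_
  · exact integral_nonneg fun z => mul_nonneg (h.mu0 z) (mul_self_nonneg _)
  · rw [e1]
    exact integral_nonneg fun z => mul_nonneg (h.pi0 z).le (mul_self_nonneg _)
  · intro m
    refine le_trans ?_ (hM m)
    simp only [h.push hf]
    have hBu := h.uu_BM hf (m + 1)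
    have e2 : bb μ t q f (m + 2) = ∫ x, π x * (opr t f x * opr t (uu t q f (m + 1)) x) := by
      simp only [mul_comm (opr t f _)]
      rw [h.adj hf (h.ht.op_BM hBu)]; rfl
    rw [e2]
    refine integral_mono (Integrable.mulBM h.piI (hB.mul (h.ht.op_BM hBu))) ?_ fun x => ?_
    · refine (Integrable.mulBM h.piI (h.ht.op_BM hBu)).abs.congr (Eventually.of_forall fun x => ?_)
      simp only; congr 1; ring
    · simp only
      rw [show π x * (1 + opr t (uu t q f (m + 1)) x) - π x = π x * opr t (uu t q f (m + 1)) x by ring,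
        abs_mul, abs_of_pos (h.pi0 x)]
      refine mul_le_mul_of_nonneg_left ?_ (h.pi0 x).le
      refine (le_abs_self _).trans ?_
      rw [abs_mul]
      exact mul_le_of_le_one_left (abs_nonneg _) (hT1 x)

theorem DA.one_mem (h : DA π μ t q) (ν : A → ℝ) (h0 : ∀ β, 0 ≤ ν β) (h1 : (∫ β, ν β) = 1) (m : ℕ) :
      (∫ β', |(∫ β, kIter (kk t q) m β β' * ν β) - π β'|) ≤ 2 * 1 ^ (m + 1) := by
  have hm := h.k_MD.iter h.k_le m
  obtain ⟨i1, i2⟩ := hm.push_int (integrable_of_one h1)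
  have hp : ∀ y, 0 ≤ ∫ β, kIter (kk t q) m β y * ν β :=
    fun y => integral_nonneg fun x => mul_nonneg (hm.nonneg _ _) (h0 x)
  calc _ ≤ ∫ y, ((∫ β, kIter (kk t q) m β y * ν β) + π y) := by
        refine integral_mono (i1.sub h.piI).abs (i1.add h.piI) fun y => ?_
        refine (abs_sub _ _).trans ?_
        rw [abs_of_nonneg (hp y), abs_of_pos (h.pi0 y)]
    _ = _ := by rw [integral_add i1 h.piI, i2, h1, h.pi1]; norm_num

theorem DA.main (h : DA π μ t q) {f : C → ℝ} (hf : BM f)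
    (hv : ∀ x, ∃ c, ∫ z, t x z * (f z - c) ^ 2 ≤ 1) {ρ : ℝ} (hρ : 0 ≤ ρ)
    (H : ∀ ν : A → ℝ, (∀ β, 0 ≤ ν β) → (∫ β, ν β) = 1 →
    Integrable (fun β => ν β ^ 2 / π β) →
    ∃ Mν : ℝ, ∀ m : ℕ,
      (∫ β', |(∫ β, kIter (kk t q) m β β' * ν β) - π β'|) ≤ Mν * ρ ^ (m + 1)) :
    (1 - ρ) * ((∫ z, μ z * f z ^ 2) - (∫ z, μ z * f z) ^ 2) ≤ 1 := by
  obtain ⟨K, hK⟩ := hf.2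
  set e := ∫ z, μ z * f z with he
  set L := |K| + |e| + 1 with hL
  have hLp : 0 < L := by positivity
  set g : C → ℝ := fun z => L⁻¹ * (f z + (-e)) with hg
  have hgB : BM g := (BM.const L⁻¹).mul (hf.add (BM.const (-e)))
  have hg1 : ∀ z, |g z| ≤ 1 := by
    intro z
    rw [hg]; simp only
    rw [abs_mul, abs_inv, abs_of_pos hLp, inv_mul_le_iff₀ hLp]
    have := abs_add_le (f z) (-e)
    rw [abs_neg] at this
    linarith [hK z, le_abs_self K]
  have i1 : Integrable (fun z => μ z * f z) := Integrable.mulBM h.muI hf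
  have i2 : Integrable (fun z => μ z * f z ^ 2) := by
    simpa only [pow_two] using Integrable.mulBM h.muI (hf.mul hf)
  have hg0 : ∫ z, μ z * g z = 0 := by
    calc _ = ∫ z, L⁻¹ * (μ z * f z - e * μ z) := by congr 1; ext z; rw [hg]; ring
      _ = 0 := by
        rw [integral_const_mul, integral_sub i1 (h.muI.const_mul e), integral_const_mul, h.mu1,
          ← he]; ring
  have hr := h.rate hgB hg1 hg0 hρ H
  have b0 : bb μ t q g 0 = L⁻¹ ^ 2 * ((∫ z, μ z * f z ^ 2) - e ^ 2) := by
    calc _ = ∫ z, (L⁻¹ ^ 2 * (μ z * f z ^ 2) + (-(L⁻¹ ^ 2 * 2 * e)) * (μ z * f z)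
            + (L⁻¹ ^ 2 * e ^ 2) * μ z) := by
          rw [bb]; congr 1; ext z; rw [uu, hg]; ring
      _ = _ := by
        rw [int_quad i2 i1 h.muI, h.mu1, ← he]; ring
  have e0 : bb μ t q g 0 = ∫ x, π x * opr t (fun z => g z * g z) x := by
    have := h.adj (hgB.mul hgB) (BM.const 1)
    simp only [one_mul, h.hq.op_const, mul_one] at this
    rw [this]; rfl
  have e1 : bb μ t q g 1 = ∫ x, π x * (opr t g x * opr t g x) := by
    rw [h.adj hgB (h.ht.op_BM hgB)]; rfl
  have hB := h.ht.op_BM hgB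
  have hd : bb μ t q g 0 - bb μ t q g 1 ≤ L⁻¹ ^ 2 := by
    have j0 := Integrable.mulBM h.piI (h.ht.op_BM (hgB.mul hgB))
    have j1 := Integrable.mulBM h.piI (hB.mul hB)
    rw [e0, e1, ← integral_sub j0 j1]
    calc _ ≤ ∫ x, π x * L⁻¹ ^ 2 := by
          refine integral_mono (j0.sub j1) (h.piI.mul_const _) fun x => ?_
          simp only
          rw [← mul_sub]
          refine mul_le_mul_of_nonneg_left ?_ (h.pi0 x).le
          obtain ⟨c, hc⟩ := hv x
          set d := L⁻¹ * (c - e) with hdd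
          set w := opr t g x with hw
          have k1 : Integrable (fun z => t x z * g z) := Integrable.mulBM (h.ht.int x) hgB
          have k2 : Integrable (fun z => t x z * (g z * g z)) :=
            Integrable.mulBM (h.ht.int x) (hgB.mul hgB)
          have : L⁻¹ ^ 2 * ∫ z, t x z * (f z - c) ^ 2
              = opr t (fun z => g z * g z) x - (2 * d * w - d ^ 2) := by
            rw [← integral_const_mul]
            calc _ = ∫ z, (1 * (t x z * (g z * g z)) + (-(2 * d)) * (t x z * g z) + d ^ 2 * t x z) := by
                  congr 1; ext z; rw [hg, hdd]; ring
              _ = _ := by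
                rw [int_quad k2 k1 (h.ht.int x), h.ht.one, hw]
                simp only [opr]
                ring
          have h3 : L⁻¹ ^ 2 * ∫ z, t x z * (f z - c) ^ 2 ≤ L⁻¹ ^ 2 * 1 :=
            mul_le_mul_of_nonneg_left hc (by positivity)
          nlinarith [sq_nonneg (w - d)]
      _ = _ := by rw [integral_mul_const, h.pi1, one_mul]
  have hL2 : 0 < L⁻¹ ^ 2 := by positivity
  have : L⁻¹ ^ 2 * ((1 - ρ) * ((∫ z, μ z * f z ^ 2) - e ^ 2)) ≤ L⁻¹ ^ 2 * 1 := by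
    calc _ = (1 - ρ) * bb μ t q g 0 := by rw [b0]; ring
      _ ≤ bb μ t q g 0 - bb μ t q g 1 := by linarith
      _ ≤ _ := by linarith
  exact le_of_mul_le_mul_left this hL2

end abs

theorem nphi_pos (x : ℝ) : 0 < nphi x := by unfold nphi; positivity

theorem nphi_cont : Continuous nphi := by unfold nphi; fun_prop

theorem nphi_neg (x : ℝ) : nphi (-x) = nphi x := by simp [nphi]

theorem nphi_eq (x : ℝ) : nphi x = (Real.sqrt (2 * Real.pi))⁻¹ * Real.exp (-(1 / 2) * x ^ 2) := by
  unfold nphi; congr 2; ring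

theorem sq_exp_int {b : ℝ} (hb : 0 < b) : Integrable fun x : ℝ => x ^ 2 * Real.exp (-b * x ^ 2) := by
  have := integrable_rpow_mul_exp_neg_mul_sq hb (s := 2) (by norm_num)
  simpa only [Real.rpow_two] using this

theorem nphi_int : Integrable nphi := by
  simp only [funext nphi_eq]
  exact (integrable_exp_neg_mul_sq (by norm_num)).const_mul _

theorem nphi_int1 : Integrable (fun x => x * nphi x) := by
  have := (integrable_mul_exp_neg_mul_sq (b := 1 / 2) (by norm_num)).const_mul (Real.sqrt (2 * Real.pi))⁻¹
  refine this.congr (Eventually.of_forall fun x => ?_)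
  simp only [nphi_eq]; ring

theorem nphi_int2 : Integrable (fun x => x ^ 2 * nphi x) := by
  have := (sq_exp_int (b := 1 / 2) (by norm_num)).const_mul (Real.sqrt (2 * Real.pi))⁻¹
  refine this.congr (Eventually.of_forall fun x => ?_)
  simp only [nphi_eq]; ring

theorem nphi_deriv (x : ℝ) : HasDerivAt nphi (-(x * nphi x)) x := by
  have h : HasDerivAt (fun x : ℝ => -(x ^ 2) / 2) (-x) x := by
    have := ((hasDerivAt_pow 2 x).neg).div_const 2
    convert! this using 1
    simp
    ring
  have := h.exp.const_mul (Real.sqrt (2 * Real.pi))⁻¹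
  convert! this using 1
  unfold nphi; ring

theorem nPhi_pos (x : ℝ) : 0 < nPhi x := by
  unfold nPhi
  rw [setIntegral_pos_iff_support_of_nonneg_ae (Eventually.of_forall fun x => (nphi_pos x).le)
    nphi_int.integrableOn]
  have : Function.support nphi = Set.univ := by
    ext x; simp [(nphi_pos x).ne']
  rw [this, Set.univ_inter]
  simp

theorem nPhi_le (x : ℝ) : nPhi x ≤ ∫ x, nphi x :=
  setIntegral_le_integral nphi_int (Eventually.of_forall fun x => (nphi_pos x).le)

theorem nPhi_mono : Monotone nPhi := fun x y h =>
  setIntegral_mono_set nphi_int.integrableOn (Eventually.of_forall fun x => (nphi_pos x).le)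
    (Set.Iic_subset_Iic.2 h).eventuallyLE

theorem G0 (θ : ℝ) : ∫ z in Set.Ioi 0, nphi (z - θ) = nPhi θ := by
  unfold nPhi
  rw [integral_Iic_eq_integral_Iio, ← integral_indicator measurableSet_Ioi,
    ← integral_indicator measurableSet_Iio,
    ← integral_sub_left_eq_self (fun x => (Set.Iio θ).indicator nphi x) volume θ]
  congr 1; ext z
  by_cases h : 0 < z
  · rw [Set.indicator_of_mem (by simpa using h), Set.indicator_of_mem (by simpa using h),
      ← nphi_neg]; congr 1; ring
  · rw [Set.indicator_of_notMem (by simpa using h), Set.indicator_of_notMem (by simpa using h)]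

theorem G1 (θ : ℝ) : ∫ z in Set.Ioi 0, (z - θ) * nphi (z - θ) = nphi θ := by
  have hd : ∀ z : ℝ, HasDerivAt (fun z => -nphi (z - θ)) ((z - θ) * nphi (z - θ)) z := by
    intro z
    have := ((nphi_deriv (z - θ)).comp_sub_const z θ).neg
    convert! this using 1; ring
  have i1 : Integrable (fun z => (z - θ) * nphi (z - θ)) := nphi_int1.comp_sub_right θ
  have i0 : Integrable (fun z => -nphi (z - θ)) := (nphi_int.comp_sub_right θ).neg
  rw [integral_Ioi_of_hasDerivAt_of_tendsto' (fun z _ => hd z) i1.integrableOn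
    (tendsto_zero_of_hasDerivAt_of_integrableOn_Ioi (a := 0) (fun z _ => hd z) i1.integrableOn
      i0.integrableOn)]
  simp [nphi_neg]

theorem G2 (θ : ℝ) : ∫ z in Set.Ioi 0, (z - θ) ^ 2 * nphi (z - θ) = nPhi θ - θ * nphi θ := by
  have hd : ∀ z : ℝ, HasDerivAt (fun z => -((z - θ) * nphi (z - θ)))
      ((z - θ) ^ 2 * nphi (z - θ) - nphi (z - θ)) z := by
    intro z
    have := (((hasDerivAt_id z).sub_const θ).mul ((nphi_deriv (z - θ)).comp_sub_const z θ)).neg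
    convert! this using 1
    simp only [id]; ring
  have i2 : Integrable (fun z => (z - θ) ^ 2 * nphi (z - θ)) := nphi_int2.comp_sub_right θ
  have i1 : Integrable (fun z => -((z - θ) * nphi (z - θ))) := (nphi_int1.comp_sub_right θ).neg
  have i0 : Integrable (fun z => nphi (z - θ)) := (nphi_int.comp_sub_right θ)
  have := integral_Ioi_of_hasDerivAt_of_tendsto' (a := (0 : ℝ)) (fun z _ => hd z) (i2.sub i0).integrableOn
    (tendsto_zero_of_hasDerivAt_of_integrableOn_Ioi (a := 0) (fun z _ => hd z)
      (i2.sub i0).integrableOn i1.integrableOn)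
  rw [integral_sub i2.integrableOn i0.integrableOn, G0] at this
  simp only [zero_sub, nphi_neg] at this
  linarith

theorem tn_eq (θ : ℝ) : tn θ true = (Set.Ioi 0).indicator (fun z => nphi (z - θ) / nPhi θ) := by
  ext z; simp [tn, Set.indicator]

theorem tn_nonneg (θ z : ℝ) : 0 ≤ tn θ true z := by
  rw [tn_eq]; exact Set.indicator_nonneg (fun z _ => (div_pos (nphi_pos _) (nPhi_pos _)).le) z

theorem tn_mul (θ : ℝ) (f : ℝ → ℝ) : ∫ z, tn θ true z * f z =
    (nPhi θ)⁻¹ * ∫ z in Set.Ioi 0, f z * nphi (z - θ) := by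
  rw [← integral_indicator measurableSet_Ioi, ← integral_const_mul, tn_eq]
  congr 1; ext z
  by_cases h : z ∈ Set.Ioi (0 : ℝ) <;> simp only [Set.indicator, h, if_true, if_false]
  · ring
  · ring

theorem tn_int (θ : ℝ) {f : ℝ → ℝ} (hf : Integrable fun z => f z * nphi (z - θ)) :
    Integrable fun z => tn θ true z * f z := by
  have := (hf.const_mul (nPhi θ)⁻¹).indicator (measurableSet_Ioi (a := (0 : ℝ)))
  refine this.congr (Eventually.of_forall fun z => ?_)
  rw [tn_eq]
  by_cases h : z ∈ Set.Ioi (0 : ℝ) <;> simp only [Set.indicator, h, if_true, if_false]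
  · ring
  · ring

theorem tn_one (θ : ℝ) : ∫ z, tn θ true z = 1 := by
  have := tn_mul θ (fun _ => 1)
  simp only [mul_one, one_mul, G0] at this
  rw [this, inv_mul_cancel₀ (nPhi_pos θ).ne']

theorem tn_var (θ : ℝ) : ∃ c, Integrable (fun z => tn θ true z * (z - c) ^ 2) ∧
    ∫ z, tn θ true z * (z - c) ^ 2 ≤ 1 := by
  have hP := nPhi_pos θ
  set h := nphi θ / nPhi θ with hh
  have i2 : Integrable (fun z => (z - θ) ^ 2 * nphi (z - θ)) := nphi_int2.comp_sub_right θ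
  have i1 : Integrable (fun z => (z - θ) * nphi (z - θ)) := nphi_int1.comp_sub_right θ
  have i0 : Integrable (fun z => nphi (z - θ)) := (nphi_int.comp_sub_right θ)
  have e : (fun z => (z - (θ + h)) ^ 2 * nphi (z - θ)) = fun z =>
      (z - θ) ^ 2 * nphi (z - θ) + (h ^ 2 * nphi (z - θ) - 2 * h * ((z - θ) * nphi (z - θ))) := by
    ext z; ring
  have ir : Integrable fun z => h ^ 2 * nphi (z - θ) - 2 * h * ((z - θ) * nphi (z - θ)) :=
    (i0.const_mul _).sub (i1.const_mul _)
  refine ⟨θ + h, tn_int θ ?_, ?_⟩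
  · rw [e]; exact i2.add ir
  · rw [tn_mul, e, integral_add i2.integrableOn ir.integrableOn,
      integral_sub (i0.const_mul _).integrableOn (i1.const_mul _).integrableOn, integral_const_mul,
      integral_const_mul, G0, G1, G2]
    have hm : 0 ≤ θ * nPhi θ + nphi θ := by
      have : ∫ z in Set.Ioi 0, z * nphi (z - θ) = θ * nPhi θ + nphi θ := by
        rw [← G0, ← G1, ← integral_const_mul, ← integral_add (i0.const_mul _).integrableOn
          i1.integrableOn]
        congr 1; ext z; ring
      rw [← this]
      exact setIntegral_nonneg measurableSet_Ioi fun z hz => mul_nonneg (le_of_lt hz) (nphi_pos _).le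
    have hp : nphi θ = h * nPhi θ := by rw [hh]; field_simp
    rw [hp] at hm ⊢
    have h0 : 0 ≤ h := (div_pos (nphi_pos θ) hP).le
    rw [inv_mul_le_iff₀ hP]
    nlinarith [mul_nonneg h0 hm]

/-- truncation -/
def clip (N : ℝ) (z : ℝ) : ℝ := max 0 (min z N)

theorem clip_BM (N : ℝ) : BM (clip N) := by
  refine ⟨by unfold clip; fun_prop, |N|, fun z => ?_⟩
  unfold clip
  rw [abs_of_nonneg (le_max_left _ _)]
  exact max_le (abs_nonneg _) ((min_le_right _ _).trans (le_abs_self _))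

theorem clip_lip (N x y : ℝ) : (clip N x - clip N y) ^ 2 ≤ (x - y) ^ 2 := by
  rw [sq_le_sq]
  unfold clip
  refine (abs_max_sub_max_le_max _ _ _ _).trans ?_
  have := abs_min_sub_min_le_max x N y N
  simp only [sub_self, abs_zero] at this ⊢
  exact max_le (abs_nonneg _) (this.trans (max_le le_rfl (abs_nonneg _)))

theorem clip_var (N θ : ℝ) : ∃ c, ∫ z, tn θ true z * (clip N z - c) ^ 2 ≤ 1 := by
  obtain ⟨c, i, hc⟩ := tn_var θ
  refine ⟨clip N c, le_trans (integral_mono_of_nonneg ?_ i ?_) hc⟩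
  · exact Eventually.of_forall fun z => mul_nonneg (tn_nonneg _ _) (sq_nonneg _)
  · exact Eventually.of_forall fun z => mul_le_mul_of_nonneg_left (clip_lip _ _ _) (tn_nonneg _ _)

/-- half normal density -/
def hn (b D z : ℝ) : ℝ := if 0 < z then D * Real.exp (-b * z ^ 2) else 0

theorem hn_mul (b D : ℝ) (f : ℝ → ℝ) : ∫ z, hn b D z * f z =
    D * ∫ z in Set.Ioi 0, f z * Real.exp (-b * z ^ 2) := by
  rw [← integral_indicator measurableSet_Ioi, ← integral_const_mul]
  congr 1; ext z
  by_cases h : 0 < z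
  · rw [hn, if_pos h, Set.indicator_of_mem (Set.mem_Ioi.2 h)]; ring
  · rw [hn, if_neg h, Set.indicator_of_notMem (by simpa using h)]; ring

theorem hn_int {b D : ℝ} {f : ℝ → ℝ} (hf : Integrable fun z => f z * Real.exp (-b * z ^ 2)) :
    Integrable fun z => hn b D z * f z := by
  have := (hf.const_mul D).indicator (measurableSet_Ioi (a := (0 : ℝ)))
  refine this.congr (Eventually.of_forall fun z => ?_)
  by_cases h : 0 < z
  · simp only [hn, if_pos h]; rw [Set.indicator_of_mem (Set.mem_Ioi.2 h)]; ring
  · simp only [hn, if_neg h]; rw [Set.indicator_of_notMem (by simpa using h)]; ring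

theorem exp_deriv (b z : ℝ) : HasDerivAt (fun z : ℝ => Real.exp (-b * z ^ 2))
    (-(2 * b) * (z * Real.exp (-b * z ^ 2))) z := by
  have := ((hasDerivAt_pow 2 z).const_mul (-b)).exp
  convert! this using 1
  simp; ring

theorem J1 {b : ℝ} (hb : 0 < b) : ∫ z in Set.Ioi 0, z * Real.exp (-b * z ^ 2) = 1 / (2 * b) := by
  have i1 := (integrable_mul_exp_neg_mul_sq hb).const_mul (-(2 * b))
  have i0 := integrable_exp_neg_mul_sq hb
  have := integral_Ioi_of_hasDerivAt_of_tendsto' (a := (0 : ℝ)) (fun z _ => exp_deriv b z) i1.integrableOn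
    (tendsto_zero_of_hasDerivAt_of_integrableOn_Ioi (a := 0) (fun z _ => exp_deriv b z)
      i1.integrableOn i0.integrableOn)
  rw [integral_const_mul] at this
  simp only [ne_eq, OfNat.ofNat_ne_zero, not_false_eq_true, zero_pow, mul_zero, Real.exp_zero] at this
  rw [eq_div_iff (by positivity)]
  linarith

theorem J2 {b : ℝ} (hb : 0 < b) : ∫ z in Set.Ioi 0, z ^ 2 * Real.exp (-b * z ^ 2) =
    (∫ z in Set.Ioi 0, Real.exp (-b * z ^ 2)) / (2 * b) := by
  have i2 := (sq_exp_int hb).const_mul (2 * b)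
  have i1 := (integrable_mul_exp_neg_mul_sq hb)
  have i0 := integrable_exp_neg_mul_sq hb
  have hd : ∀ z : ℝ, HasDerivAt (fun z : ℝ => z * Real.exp (-b * z ^ 2))
      (Real.exp (-b * z ^ 2) - 2 * b * (z ^ 2 * Real.exp (-b * z ^ 2))) z := by
    intro z
    have := (hasDerivAt_id z).mul (exp_deriv b z)
    convert! this using 1
    simp only [id]; ring
  have := integral_Ioi_of_hasDerivAt_of_tendsto' (a := (0 : ℝ)) (fun z _ => hd z) (i0.sub i2).integrableOn
    (tendsto_zero_of_hasDerivAt_of_integrableOn_Ioi (a := 0) (fun z _ => hd z)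
      (i0.sub i2).integrableOn i1.integrableOn)
  rw [integral_sub i0.integrableOn i2.integrableOn, integral_const_mul] at this
  simp only [zero_mul, sub_zero] at this
  rw [eq_div_iff (by positivity)]
  linarith

theorem hn_tendsto {b D : ℝ} {F : ℕ → ℝ → ℝ} {f : ℝ → ℝ} (hf : Integrable fun z => f z * Real.exp (-b * z ^ 2))
    (hm : ∀ n, Measurable (F n)) (hF : ∀ n z, 0 < z → |F n z| ≤ f z)
    (hl : ∀ z, 0 < z → Tendsto (fun n => F n z) atTop (nhds (f z))) :
    Tendsto (fun n => ∫ z, hn b D z * F n z) atTop (nhds (∫ z, hn b D z * f z)) := by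
  have hmeas : Measurable (hn b D) := by
    unfold hn
    exact Measurable.ite measurableSet_Ioi (by fun_prop) measurable_const
  refine tendsto_integral_of_dominated_convergence (fun z => |hn b D z * f z|)
    (fun n => (hmeas.mul (hm n)).aestronglyMeasurable) (hn_int hf).abs
    (fun n => Eventually.of_forall fun z => ?_) (Eventually.of_forall fun z => ?_)
  · by_cases h : 0 < z
    · rw [Real.norm_eq_abs, abs_mul, abs_mul]
      exact mul_le_mul_of_nonneg_left ((hF n z h).trans (le_abs_self _)) (abs_nonneg _)
    · simp [hn, h]
  · by_cases h : 0 < z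
    · exact (hl z h).const_mul _
    · simp [hn, h]

theorem hn_limit {b D ρ : ℝ} (hb : 0 < b) (h1 : ∫ z, hn b D z = 1)
    (H : ∀ N : ℕ, (1 - ρ) * ((∫ z, hn b D z * clip N z ^ 2) - (∫ z, hn b D z * clip N z) ^ 2) ≤ 1) :
    (1 - ρ) * ((1 - 2 / Real.pi) / (2 * b)) ≤ 1 := by
  have hcl : ∀ z : ℝ, 0 < z → Tendsto (fun n : ℕ => clip n z) atTop (nhds z) := by
    intro z hz
    refine tendsto_const_nhds.congr' ?_
    filter_upwards [eventually_ge_atTop (Nat.ceil z)] with n hn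
    rw [clip, min_eq_left ((Nat.le_ceil z).trans (by exact_mod_cast hn)), max_eq_right hz.le]
  have hle : ∀ (n : ℕ) (z : ℝ), 0 < z → |clip n z| ≤ z := by
    intro n z hz
    unfold clip
    rw [abs_of_nonneg (le_max_left _ _)]
    exact max_le hz.le (min_le_left _ _)
  have t1 := hn_tendsto (D := D) (f := fun z => z) (integrable_mul_exp_neg_mul_sq hb)
    (fun n : ℕ => (clip_BM n).1) hle hcl
  have t2 := hn_tendsto (D := D) (f := fun z => z ^ 2) (F := fun (n : ℕ) z => clip n z ^ 2) (sq_exp_int hb)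
    (fun n : ℕ => (clip_BM n).1.pow_const 2) (fun n z hz => by
      rw [abs_pow]; exact pow_le_pow_left₀ (abs_nonneg _) (hle n z hz) 2)
    (fun z hz => (hcl z hz).pow 2)
  have lim := le_of_tendsto ((t2.sub (t1.pow 2)).const_mul (1 - ρ)) (Eventually.of_forall H)
  rw [hn_mul, hn_mul, J1 hb, J2 hb] at lim
  have h0 := hn_mul b D (fun _ => 1)
  simp only [mul_one, one_mul] at h0
  rw [h1] at h0
  set J := ∫ z in Set.Ioi 0, Real.exp (-b * z ^ 2) with hJ
  have hJ2 : J ^ 2 = Real.pi / (4 * b) := by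
    rw [hJ, integral_gaussian_Ioi, div_pow, Real.sq_sqrt (by positivity)]; field_simp; norm_num
  have hD : D ^ 2 * (Real.pi / (4 * b)) = 1 := by rw [← hJ2, ← mul_pow, ← h0, one_pow]
  have hD' : D ^ 2 = 4 * b / Real.pi := by
    have := Real.pi_pos
    field_simp at hD ⊢
    linarith
  have : D * (J / (2 * b)) - (D * (1 / (2 * b))) ^ 2 = (1 - 2 / Real.pi) / (2 * b) := by
    have e1 : D * (J / (2 * b)) = 1 / (2 * b) := by rw [← mul_div_assoc, ← h0]
    rw [e1, mul_pow, hD']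
    have := Real.pi_pos
    field_simp
    ring
  rw [this] at lim
  exact lim

theorem quad_nonneg {p : ℕ} {S : Matrix (Fin p) (Fin p) ℝ} (hS : S.PosDef) (x : Fin p → ℝ) :
    0 ≤ x ⬝ᵥ S.mulVec x := by
  have := hS.posSemidef.dotProduct_mulVec_nonneg x
  simpa using this

open scoped MatrixOrder in
theorem mgauss {p : ℕ} {S : Matrix (Fin p) (Fin p) ℝ} (hS : S.PosDef) :
    ∫ x : Fin p → ℝ, Real.exp (-(x ⬝ᵥ S.mulVec x) / 2) = Real.sqrt ((2 * Real.pi) ^ p / S.det) := by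
  obtain ⟨B, hB⟩ : ∃ B : Matrix (Fin p) (Fin p) ℝ, S = Bᵀ * B := by
    obtain ⟨B, hB⟩ := CStarAlgebra.nonneg_iff_eq_star_mul_self.mp hS.posSemidef.nonneg
    exact ⟨B, by simpa [star_eq_conjTranspose, conjTranspose_eq_transpose_of_trivial] using hB⟩
  have hdet : S.det = B.det ^ 2 := by rw [hB, det_mul, det_transpose]; ring
  have hd0 : B.det ≠ 0 := by
    intro h; have := hS.det_pos; rw [hdet, h] at this; norm_num at this
  have e1 : ∀ x : Fin p → ℝ, x ⬝ᵥ S.mulVec x = ∑ i, (B.mulVec x) i ^ 2 := by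
    intro x
    rw [hB, ← mulVec_mulVec, dotProduct_mulVec, vecMul_transpose]
    simp [dotProduct, pow_two]
  have hF : ∫ y : Fin p → ℝ, Real.exp (-(∑ i, y i ^ 2) / 2) = Real.sqrt (2 * Real.pi) ^ p := by
    have : ∀ y : Fin p → ℝ, Real.exp (-(∑ i, y i ^ 2) / 2) = ∏ i, Real.exp (-(1 / 2) * y i ^ 2) := by
      intro y
      rw [← Real.exp_sum]; congr 1
      rw [← Finset.mul_sum]; ring
    simp only [this]
    rw [integral_fintype_prod_volume_eq_prod (f := fun _ v => Real.exp (-(1 / 2) * v ^ 2))]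
    simp only [integral_gaussian, Finset.prod_const, Finset.card_univ, Fintype.card_fin]
    congr 2; ring
  have hmap := Real.map_matrix_volume_pi_eq_smul_volume_pi hd0
  have hcont : Continuous (toLin' B) := LinearMap.continuous_of_finiteDimensional _
  have h3 := integral_map (μ := (volume : Measure (Fin p → ℝ))) hcont.measurable.aemeasurable
    (f := fun y : Fin p → ℝ => Real.exp (-(∑ i, y i ^ 2) / 2))
    (by apply Continuous.aestronglyMeasurable; fun_prop)
  rw [hmap, integral_smul_measure, hF] at h3
  simp only [e1]
  simp only [toLin'_apply] at h3
  rw [← h3, ENNReal.toReal_ofReal (abs_nonneg _), hdet, smul_eq_mul]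
  rw [Real.sqrt_div (by positivity), Real.sqrt_sq_eq_abs, abs_inv, Real.sqrt_eq_rpow (2 * Real.pi),
    Real.sqrt_eq_rpow, ← Real.rpow_natCast, ← Real.rpow_natCast, ← Real.rpow_mul (by positivity),
    ← Real.rpow_mul (by positivity), mul_comm (1 / 2 : ℝ)]
  ring

theorem mgauss_int {p : ℕ} {S : Matrix (Fin p) (Fin p) ℝ} (hS : S.PosDef) :
    Integrable fun x : Fin p → ℝ => Real.exp (-(x ⬝ᵥ S.mulVec x) / 2) := by
  by_contra h
  have := mgauss hS
  rw [integral_undef h] at this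
  have h2 : 0 < Real.sqrt ((2 * Real.pi) ^ p / S.det) := by have := hS.det_pos; positivity
  rw [← this] at h2
  exact lt_irrefl _ h2

theorem mvn_one {p : ℕ} {S : Matrix (Fin p) (Fin p) ℝ} (hS : S.PosDef) (m : Fin p → ℝ) :
    ∫ x, mvn m S⁻¹ x = 1 := by
  have hd := hS.det_pos
  have hu : IsUnit S.det := hd.ne'.isUnit
  simp only [mvn, nonsing_inv_nonsing_inv S hu]
  rw [integral_const_mul, integral_sub_right_eq_self (fun x => Real.exp (-(x ⬝ᵥ S.mulVec x) / 2)) m,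
    mgauss hS, ← Real.sqrt_mul (by rw [det_nonsing_inv, Ring.inverse_eq_inv']; positivity),
    det_nonsing_inv, Ring.inverse_eq_inv', Real.sqrt_eq_one]
  field_simp

/-- conditional density of β given z -/
def qq {p : ℕ} (X : Matrix (Fin 1) (Fin p) ℝ) (Q : Matrix (Fin p) (Fin p) ℝ) (z : ℝ) (β : Fin p → ℝ) : ℝ :=
  mvn ((Xᵀ * X + Q)⁻¹.mulVec (z • X 0)) (Xᵀ * X + Q)⁻¹ β

theorem kAC_eq {p : ℕ} (X : Matrix (Fin 1) (Fin p) ℝ) (Q : Matrix (Fin p) (Fin p) ℝ) :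
    kAC X (fun _ => true) 0 Q = kk (fun β z => tn (X 0 ⬝ᵥ β) true z) (qq X Q) := by
  ext β β'
  unfold kAC kk qq
  have hmp := (volume_preserving_funUnique (Fin 1) ℝ)
  rw [← hmp.integral_comp']
  congr 1; ext z
  have : Xᵀ *ᵥ z + Q *ᵥ 0 = (z 0) • X 0 := by
    ext j
    simp [mulVec, dotProduct, mul_comm]
  rw [this]
  simp [MeasurableEquiv.funUnique]

theorem sig_posDef {p : ℕ} (X : Matrix (Fin 1) (Fin p) ℝ) {Q : Matrix (Fin p) (Fin p) ℝ}
    (hQ : Q.PosDef) : (Xᵀ * X + Q).PosDef := by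
  have h := posSemidef_conjTranspose_mul_self X
  rw [conjTranspose_eq_transpose_of_trivial] at h
  exact PosDef.posSemidef_add h hQ

theorem square {p : ℕ} (X : Matrix (Fin 1) (Fin p) ℝ) {Q : Matrix (Fin p) (Fin p) ℝ}
    (hQ : Q.PosDef) (z : ℝ) (β : Fin p → ℝ) :
    (β - (Xᵀ * X + Q)⁻¹ *ᵥ (z • X 0)) ⬝ᵥ ((Xᵀ * X + Q) *ᵥ (β - (Xᵀ * X + Q)⁻¹ *ᵥ (z • X 0))) +
      (1 - (X * (Xᵀ * X + Q)⁻¹ * Xᵀ) 0 0) * z ^ 2 = (z - X 0 ⬝ᵥ β) ^ 2 + β ⬝ᵥ (Q *ᵥ β) := by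
  have hS := sig_posDef X hQ
  set S := Xᵀ * X + Q with hSd
  have hu : IsUnit S.det := hS.det_pos.ne'.isUnit
  set m := S⁻¹ *ᵥ (z • X 0) with hm
  have hSm : S *ᵥ m = z • X 0 := by rw [hm, mulVec_mulVec, mul_nonsing_inv _ hu, one_mulVec]
  have hsym : Sᵀ = S := by
    have := hS.isHermitian.eq
    rwa [conjTranspose_eq_transpose_of_trivial] at this
  have h1 : m ⬝ᵥ (S *ᵥ β) = z * (X 0 ⬝ᵥ β) := by
    rw [dotProduct_mulVec, ← mulVec_transpose, hsym, hSm, smul_dotProduct, smul_eq_mul]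
  have h2 : β ⬝ᵥ (S *ᵥ m) = z * (X 0 ⬝ᵥ β) := by
    rw [hSm, dotProduct_smul, smul_eq_mul, dotProduct_comm]
  have h3 : m ⬝ᵥ (S *ᵥ m) = z ^ 2 * (X * S⁻¹ * Xᵀ) 0 0 := by
    rw [hSm, hm, mulVec_smul, smul_dotProduct, dotProduct_smul, smul_eq_mul, smul_eq_mul]
    have : (X * S⁻¹ * Xᵀ) 0 0 = S⁻¹ *ᵥ X 0 ⬝ᵥ X 0 := by
      rw [Matrix.mul_assoc, mul_apply, dotProduct_comm]
      simp [dotProduct, mulVec, mul_apply]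
    rw [this]; ring
  have h4 : β ⬝ᵥ (S *ᵥ β) = (X 0 ⬝ᵥ β) ^ 2 + β ⬝ᵥ (Q *ᵥ β) := by
    rw [hSd, add_mulVec, dotProduct_add, ← mulVec_mulVec, dotProduct_mulVec, vecMul_transpose]
    congr 1
    simp [dotProduct, mulVec, pow_two]
  rw [mulVec_sub, sub_dotProduct, dotProduct_sub, dotProduct_sub, h1, h2, h3, h4]
  ring

theorem post_eq {p : ℕ} (X : Matrix (Fin 1) (Fin p) ℝ) (Q : Matrix (Fin p) (Fin p) ℝ) (β : Fin p → ℝ) :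
    postUnnorm X (fun _ => true) 0 Q β = nPhi (X 0 ⬝ᵥ β) * Real.exp (-(β ⬝ᵥ Q *ᵥ β) / 2) := by
  simp [postUnnorm]

theorem theDA {p : ℕ} (X : Matrix (Fin 1) (Fin p) ℝ) {Q : Matrix (Fin p) (Fin p) ℝ}
    (hQ : Q.PosDef) : ∃ D, DA (postDen X (fun _ => true) 0 Q)
      (hn ((1 - (X * (Xᵀ * X + Q)⁻¹ * Xᵀ) 0 0) / 2) D)
      (fun β z => tn (X 0 ⬝ᵥ β) true z) (qq X Q) := by
  have hS := sig_posDef X hQ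
  have hu : IsUnit (Xᵀ * X + Q).det := hS.det_pos.ne'.isUnit
  have hc0 : 0 < Real.sqrt (((2 * Real.pi) ^ p * (Xᵀ * X + Q)⁻¹.det)⁻¹) := by
    have := hS.det_pos
    rw [det_nonsing_inv, Ring.inverse_eq_inv']
    positivity
  set c := Real.sqrt (((2 * Real.pi) ^ p * (Xᵀ * X + Q)⁻¹.det)⁻¹) with hc
  have hqq : ∀ z β, qq X Q z β = c * Real.exp (-((β - (Xᵀ * X + Q)⁻¹ *ᵥ (z • X 0)) ⬝ᵥ
      ((Xᵀ * X + Q) *ᵥ (β - (Xᵀ * X + Q)⁻¹ *ᵥ (z • X 0)))) / 2) := by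
    intro z β
    rw [qq, mvn, nonsing_inv_nonsing_inv _ hu]
  have hlin : Measurable (fun β : Fin p → ℝ => X 0 ⬝ᵥ β) := by
    apply Continuous.measurable; unfold dotProduct; fun_prop
  have hPm : Measurable (postUnnorm X (fun _ => true) 0 Q) := by
    rw [funext (post_eq X Q)]
    refine (nPhi_mono.measurable.comp hlin).mul ?_
    apply Continuous.measurable; unfold dotProduct mulVec dotProduct; fun_prop
  have hP0 : ∀ β, 0 < postUnnorm X (fun _ => true) 0 Q β := by
    intro β; rw [post_eq]; exact mul_pos (nPhi_pos _) (Real.exp_pos _)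
  have hPi : Integrable (postUnnorm X (fun _ => true) 0 Q) := by
    refine ((mgauss_int hQ).const_mul (∫ x, nphi x)).mono' hPm.aestronglyMeasurable
      (Eventually.of_forall fun β => ?_)
    rw [Real.norm_eq_abs, abs_of_pos (hP0 β), post_eq]
    exact mul_le_mul_of_nonneg_right (nPhi_le _) (Real.exp_pos _).le
  have hZ : 0 < ∫ β, postUnnorm X (fun _ => true) 0 Q β := by
    rw [integral_pos_iff_support_of_nonneg (fun β => (hP0 β).le) hPi]
    have : Function.support (postUnnorm X (fun _ => true) 0 Q) = Set.univ := by
      ext β; simp [(hP0 β).ne']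
    rw [this]
    exact isOpen_univ.measure_pos volume Set.univ_nonempty
  set Z := ∫ β, postUnnorm X (fun _ => true) 0 Q β with hZd
  refine ⟨(Real.sqrt (2 * Real.pi))⁻¹ / (Z * c), ?_⟩
  refine ⟨⟨?_, fun β z => tn_nonneg _ _, fun β => tn_one _⟩, ⟨?_, ?_, ?_⟩, ?_, ?_, ?_, ?_, ?_, ?_, ?_⟩
  · have : (Function.uncurry fun (β : Fin p → ℝ) z => tn (X 0 ⬝ᵥ β) true z) = fun w =>
      if 0 < w.2 then nphi (w.2 - X 0 ⬝ᵥ w.1) / nPhi (X 0 ⬝ᵥ w.1) else 0 := by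
      ext w; simp [tn, Function.uncurry]
    rw [this]
    refine Measurable.ite (measurableSet_lt measurable_const measurable_snd) ?_ measurable_const
    exact (nphi_cont.measurable.comp (measurable_snd.sub (hlin.comp measurable_fst))).div
      (nPhi_mono.measurable.comp (hlin.comp measurable_fst))
  · have : Function.uncurry (qq X Q) = fun w => c * Real.exp (-((w.2 - (Xᵀ * X + Q)⁻¹ *ᵥ (w.1 • X 0)) ⬝ᵥ
      ((Xᵀ * X + Q) *ᵥ (w.2 - (Xᵀ * X + Q)⁻¹ *ᵥ (w.1 • X 0)))) / 2) := by
      ext w; exact hqq _ _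
    rw [this]
    apply Continuous.measurable
    unfold dotProduct mulVec dotProduct
    simp only [Pi.sub_apply, Pi.smul_apply]
    fun_prop
  · intro z β; rw [hqq]; positivity
  · intro z; exact mvn_one hS _
  · exact hPm.div_const _
  · intro β; exact div_pos (hP0 β) hZ
  · simp only [postDen]
    rw [integral_div, div_self hZ.ne']
  · unfold hn
    exact Measurable.ite measurableSet_Ioi (by fun_prop) measurable_const
  · intro z; unfold hn; split_ifs <;> positivity
  · intro β z
    by_cases h : 0 < z
    · simp only [postDen, tn, hn, h, if_true, hqq]
      rw [post_eq, ← hZd, nphi]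
      have hP := nPhi_pos (X 0 ⬝ᵥ β)
      have hsq := square X hQ z β
      set E1 := (β - (Xᵀ * X + Q)⁻¹ *ᵥ (z • X 0)) ⬝ᵥ
        ((Xᵀ * X + Q) *ᵥ (β - (Xᵀ * X + Q)⁻¹ *ᵥ (z • X 0))) with hE1
      set E2 := (X * (Xᵀ * X + Q)⁻¹ * Xᵀ) 0 0 with hE2
      have hexp : Real.exp (-(β ⬝ᵥ Q *ᵥ β) / 2) * Real.exp (-(z - X 0 ⬝ᵥ β) ^ 2 / 2) =
          Real.exp (-((1 - E2) / 2) * z ^ 2) * Real.exp (-E1 / 2) := by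
        rw [← Real.exp_add, ← Real.exp_add]; congr 1; linarith
      calc _ = (Real.sqrt (2 * Real.pi))⁻¹ / Z * (Real.exp (-(β ⬝ᵥ Q *ᵥ β) / 2) *
            Real.exp (-(z - X 0 ⬝ᵥ β) ^ 2 / 2)) := by field_simp
        _ = _ := by rw [hexp]; field_simp
    · simp [tn, hn, h]
  · refine ⟨c, fun z β => ?_⟩
    rw [hqq]
    have := quad_nonneg hS (β - (Xᵀ * X + Q)⁻¹ *ᵥ (z • X 0))
    refine mul_le_of_le_one_right hc0.le (Real.exp_le_one_iff.2 ?_)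
    linarith

/-- with n = 1, v = 0 and Y₁ = 1, the L²-geometric convergence rate of
Albert and Chib's chain satisfies ρ** ≥ 1 − (1−ψ)/(1−2/π), where ψ = XΣ⁻¹Xᵀ;
in particular ρ** is not bounded away from 1 if ψ is not bounded away from 1. -/
theorem rate_lower_bound_n_one
    (p : ℕ) (hp : 1 ≤ p)
    (X : Matrix (Fin 1) (Fin p) ℝ) (hX : X ≠ 0)
    (Q : Matrix (Fin p) (Fin p) ℝ) (hQ : Q.PosDef)
    (hSig : IsUnit (Xᵀ * X + Q).det)
    (ψ : ℝ) (hψdef : ψ = (X * (Xᵀ * X + Q)⁻¹ * Xᵀ) 0 0) (hψ : ψ ∈ Set.Ioo (0 : ℝ) 1) :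
    1 - (1 - ψ) / (1 - 2 / Real.pi)
      ≤ rhoSS (kAC X (fun _ => true) 0 Q) (postDen X (fun _ => true) 0 Q) := by
  obtain ⟨D, hDA⟩ := theDA X hQ
  rw [← hψdef] at hDA
  rw [kAC_eq, rhoSS]
  refine le_csInf ⟨1, ⟨by norm_num, le_rfl⟩, fun ν h0 h1 _ => ⟨2, hDA.one_mem ν h0 h1⟩⟩ ?_
  rintro ρ ⟨hρ, H⟩
  have hb : 0 < (1 - ψ) / 2 := by linarith [hψ.2]
  have key := hn_limit (ρ := ρ) hb hDA.mu1 fun N =>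
    hDA.main (clip_BM N) (fun β => clip_var N _) hρ.1 H
  have hpi : 0 < 1 - 2 / Real.pi := by
    rw [sub_pos, div_lt_one Real.pi_pos]; linarith [Real.pi_gt_three]
  have h1 : 0 < 1 - ψ := by linarith [hψ.2]
  rw [show 2 * ((1 - ψ) / 2) = 1 - ψ by ring, ← mul_div_assoc, div_le_one h1] at key
  have : 1 - ρ ≤ (1 - ψ) / (1 - 2 / Real.pi) := by rwa [le_div_iff₀ hpi]
  linarith
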